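/- arXiv:1907.07053 — 4 statements merged into one kernel-verified Lean document; each statement's English description precedes it below -/
import Mathlib

section
/- Let f : E → ℝ be p-times continuously differentiable (p ≥ 2) with ν-Hölder continuous p-th derivative with constant H. Then for all x,y ∈ E, the Hessian satisfies ‖∇²f(y) − ∇²Φ_{x,p}(y)‖ ≤ (H/(p−2)!)·‖y−x‖^{p+ν−2} in operator norm, where Φ_{x,p} is the p-th Taylor polynomial of f at x. -/
/-- The `p`-th order Taylor polynomial of `f` at `x`, evaluated at `y`. -/
noncomputable def taylorPoly {E : Type*} [NormedAddCommGroup E] [NormedSpace ℝ E]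
    (f : E → ℝ) (p : ℕ) (x y : E) : ℝ :=
  f x + ∑ i ∈ Finset.Icc 1 p, (1 / (i.factorial : ℝ)) * iteratedFDeriv ℝ i f x (fun _ => y - x)

/-- The Taylor formal series, truncated. -/
noncomputable def taylorSer {E : Type*} [NormedAddCommGroup E] [NormedSpace ℝ E]
    (f : E → ℝ) (p : ℕ) (x : E) : FormalMultilinearSeries ℝ E ℝ :=
  fun n => if n ≤ p then (1 / (n.factorial : ℝ)) • iteratedFDeriv ℝ n f x else 0

lemma taylorPoly_hasSeries {E : Type*} [NormedAddCommGroup E] [NormedSpace ℝ E]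
    (f : E → ℝ) (p : ℕ) (x : E) :
    HasFiniteFPowerSeriesOnBall (fun z => taylorPoly f p x z) (taylorSer f p x) x (p + 1) ⊤ := by
  refine HasFiniteFPowerSeriesOnBall.mk' ?_ (by simp) ?_
  · intro m hm
    simp [taylorSer, show ¬ m ≤ p by omega]
  · intro y _
    rw [Finset.sum_range_succ']
    simp only [taylorPoly, add_sub_cancel_left]
    rw [add_comm]
    congr 1
    · simp [taylorSer]
    · rw [Finset.sum_bij (fun i _ => i + 1)]
      · intro a ha
        simp at ha ⊢
        omega
      · intro a _ b _ h
        omega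
      · intro b hb
        simp at hb
        exact ⟨b - 1, by simp; omega, by omega⟩
      · intro a ha
        simp at ha
        simp [taylorSer, show a + 1 ≤ p by omega]

lemma fderiv_iteratedFDeriv_apply_aux {E : Type*} [NormedAddCommGroup E] [NormedSpace ℝ E]
    (f : E → ℝ) (n : ℕ) (x : E) (hd : Differentiable ℝ (iteratedFDeriv ℝ n f))
    (u : E) (w : Fin n → E) :
    fderiv ℝ (iteratedFDeriv ℝ n f) x u w = fderiv ℝ (fun y => iteratedFDeriv ℝ n f y w) x u := by
  have h := (ContinuousMultilinearMap.apply ℝ (fun _ : Fin n => E) ℝ w).hasFDerivAt.comp x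
    (hd x).hasFDerivAt
  have h2 : HasFDerivAt (fun y => iteratedFDeriv ℝ n f y w) _ x := h
  rw [h2.fderiv]
  rfl

lemma iteratedFDeriv_swap_adj {E : Type*} [NormedAddCommGroup E] [NormedSpace ℝ E]
    (f : E → ℝ) (m : ℕ) : ContDiff ℝ (m + 1 : ℕ) f → ∀ (i : Fin m) (x : E) (v : Fin (m + 1) → E),
    iteratedFDeriv ℝ (m + 1) f x (fun k => v (Equiv.swap i.castSucc i.succ k)) =
      iteratedFDeriv ℝ (m + 1) f x v := by
  induction m with
  | zero => intro _ i; exact i.elim0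
  | succ m ih =>
    intro hf i x v
    have hd1 : Differentiable ℝ (iteratedFDeriv ℝ (m + 1) f) :=
      hf.differentiable_iteratedFDeriv (by exact_mod_cast (by omega : m + 1 < m + 1 + 1))
    rw [iteratedFDeriv_succ_apply_left, iteratedFDeriv_succ_apply_left]
    rw [fderiv_iteratedFDeriv_apply_aux f _ x hd1, fderiv_iteratedFDeriv_apply_aux f _ x hd1]
    refine Fin.cases ?_ (fun j => ?_) i
    · have hg : ContDiff ℝ 2 (iteratedFDeriv ℝ m f) :=
        hf.iteratedFDeriv_right (by exact_mod_cast (by omega : 2 + m ≤ m + 1 + 1))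
      have hdg : Differentiable ℝ (fderiv ℝ (iteratedFDeriv ℝ m f)) :=
        (hg.fderiv_right (m := 1) (by norm_num)).differentiable (by norm_num)
      have key : ∀ (u : E) (w : Fin (m + 1) → E),
          fderiv ℝ (fun y => iteratedFDeriv ℝ (m + 1) f y w) x u =
          fderiv ℝ (fderiv ℝ (iteratedFDeriv ℝ m f)) x u (w 0) (Fin.tail w) := by
        intro u w
        have h0 := (hdg x).hasFDerivAt.clm_apply (hasFDerivAt_const (w 0) x)
        have h1 := (ContinuousMultilinearMap.apply ℝ (fun _ : Fin m => E) ℝ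
          (Fin.tail w)).hasFDerivAt.comp x h0
        have h2 : HasFDerivAt (fun y => iteratedFDeriv ℝ (m + 1) f y w) _ x := h1
        rw [h2.fderiv]
        simp
      rw [key, key]
      have hs : IsSymmSndFDerivAt ℝ (iteratedFDeriv ℝ m f) x :=
        hg.contDiffAt.isSymmSndFDerivAt (by simp)
      have e := hs (v 1) (v 0)
      have t : Fin.tail (Fin.tail fun k => v (Equiv.swap (Fin.castSucc (0 : Fin (m + 1)))
          (Fin.succ 0) k)) = Fin.tail (Fin.tail v) := by
        funext k
        simp only [Fin.tail]
        rw [Equiv.swap_apply_of_ne_of_ne] <;> simp [Fin.ext_iff]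
      rw [t]
      simp only [Fin.tail, Fin.castSucc_zero, Fin.succ_zero_eq_one, Equiv.swap_apply_left,
        Equiv.swap_apply_right]
      rw [e]
    · have h0 : Equiv.swap (Fin.castSucc (Fin.succ j)) (Fin.succ (Fin.succ j)) 0 = 0 := by
        apply Equiv.swap_apply_of_ne_of_ne <;> simp [Fin.ext_iff]
      have ht : (Fin.tail fun k => v (Equiv.swap (Fin.castSucc (Fin.succ j))
          (Fin.succ (Fin.succ j)) k)) =
          fun k => Fin.tail v (Equiv.swap j.castSucc j.succ k) := by
        funext k
        simp only [Fin.tail]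
        congr 1
        rw [← Fin.succ_castSucc]
        exact ((Fin.succ_injective _).map_swap j.castSucc j.succ k).symm
      rw [ht]
      simp only [h0]
      have := ih (hf.of_le (by exact_mod_cast (by omega : m + 1 ≤ m + 1 + 1))) j
      simp only [this]

lemma iteratedFDeriv_perm_real {E : Type*} [NormedAddCommGroup E] [NormedSpace ℝ E]
    (f : E → ℝ) (n : ℕ) (hf : ContDiff ℝ n f) (x : E) (σ : Equiv.Perm (Fin n)) :
    ∀ v : Fin n → E, iteratedFDeriv ℝ n f x (fun k => v (σ k)) = iteratedFDeriv ℝ n f x v := by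
  cases n with
  | zero => intro v; congr 1; funext k; exact k.elim0
  | succ m =>
    have hσ : σ ∈ Submonoid.closure
        (Set.range fun i : Fin m => Equiv.swap i.castSucc i.succ) := by
      rw [Equiv.Perm.mclosure_swap_castSucc_succ]; trivial
    induction hσ using Submonoid.closure_induction with
    | mem s hs =>
      obtain ⟨i, rfl⟩ := hs
      exact iteratedFDeriv_swap_adj f m hf i x
    | one => intro v; rfl
    | mul a b _ _ ha hb =>
      intro v
      exact (hb (fun k => v (a k))).trans (ha v)

lemma iteratedFDeriv_taylorPoly_self {E : Type*} [NormedAddCommGroup E] [NormedSpace ℝ E]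
    (f : E → ℝ) (p : ℕ) (x : E) (hf : ContDiff ℝ p f) (k : ℕ) (hk : k ≤ p) :
    iteratedFDeriv ℝ k (fun z => taylorPoly f p x z) x = iteratedFDeriv ℝ k f x := by
  ext v
  rw [(taylorPoly_hasSeries f p x).toHasFPowerSeriesOnBall.iteratedFDeriv_eq_sum_of_completeSpace]
  have hs : ∀ σ : Equiv.Perm (Fin k), taylorSer f p x k (fun i => v (σ i))
      = (1 / (k.factorial : ℝ)) * iteratedFDeriv ℝ k f x v := by
    intro σ
    have := iteratedFDeriv_perm_real f k (hf.of_le (by exact_mod_cast hk)) x σ v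
    simp only [taylorSer, hk, if_true]
    rw [← this]
    simp
  rw [Finset.sum_congr rfl (fun σ _ => hs σ)]
  have : (k.factorial : ℝ) ≠ 0 := by positivity
  simp [Fintype.card_perm]
  field_simp

lemma iteratedFDeriv_taylorPoly_top {E : Type*} [NormedAddCommGroup E] [NormedSpace ℝ E]
    (f : E → ℝ) (p : ℕ) (x : E) (hf : ContDiff ℝ p f) (y : E) :
    iteratedFDeriv ℝ p (fun z => taylorPoly f p x z) y = iteratedFDeriv ℝ p f x := by
  rw [← iteratedFDeriv_taylorPoly_self f p x hf p le_rfl]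
  have h := taylorPoly_hasSeries f p x
  have hA : AnalyticOn ℝ (fun z => taylorPoly f p x z) Set.univ := by
    have := h.toHasFPowerSeriesOnBall.analyticOnNhd.analyticOn
    simpa using this
  have h2 := (h.toHasFPowerSeriesOnBall.hasFPowerSeriesWithinOnBall
    (s := Set.univ)).iteratedFDerivWithin hA p uniqueDiffOn_univ (Set.mem_univ x)
  rw [iteratedFDerivWithin_univ, hasFPowerSeriesWithinOnBall_univ] at h2
  have h3 : HasFiniteFPowerSeriesOnBall (iteratedFDeriv ℝ p (fun z => taylorPoly f p x z))
      ((taylorSer f p x).iteratedFDerivSeries p) x 1 ⊤ :=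
    ⟨h2, fun m hm => FormalMultilinearSeries.iteratedFDerivSeries_eq_zero
      (h.finite _ (by omega))⟩
  exact h3.eq_const_of_bound_one y (by simp)

lemma taylor_int_step {E F : Type*} [NormedAddCommGroup E] [NormedSpace ℝ E]
    [NormedAddCommGroup F] [NormedSpace ℝ F] (g : E → F) (g' : E → E →L[ℝ] F) (x : E)
    (C a : ℝ) (ha : 0 ≤ a) (hg : ∀ z, HasFDerivAt g (g' z) z) (h0 : g x = 0)
    (hb : ∀ z, ‖g' z‖ ≤ C * ‖z - x‖ ^ a) (y : E) :
    ‖g y‖ ≤ C / (a + 1) * ‖y - x‖ ^ (a + 1) := by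
  set d := y - x with hd
  have hφ : ∀ t : ℝ, HasDerivAt (fun t : ℝ => g (x + t • d)) (g' (x + t • d) d) t := by
    intro t
    have h1 : HasDerivAt (fun t : ℝ => x + t • d) d t := by
      simpa using ((hasDerivAt_id t).smul_const d).const_add x
    exact (hg _).comp_hasDerivAt t h1
  have hB : ∀ t : ℝ, HasDerivAt (fun t : ℝ => C / (a + 1) * ‖d‖ ^ (a + 1) * t ^ (a + 1))
      (C / (a + 1) * ‖d‖ ^ (a + 1) * ((a + 1) * t ^ (a + 1 - 1))) t := fun t =>
    (Real.hasDerivAt_rpow_const (Or.inr (by linarith))).const_mul _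
  have key := image_norm_le_of_norm_deriv_right_le_deriv_boundary (a := 0) (b := 1)
    (f := fun t : ℝ => g (x + t • d))
    (fun t _ => (hφ t).continuousAt.continuousWithinAt)
    (fun t _ => (hφ t).hasDerivWithinAt) (by simp [h0, Real.zero_rpow (by linarith : a + 1 ≠ 0)])
    hB (by
      intro t ht
      have h1 := (g' (x + t • d)).le_opNorm d
      have h2 := hb (x + t • d)
      rw [add_sub_cancel_left, norm_smul, Real.norm_of_nonneg ht.1,
        Real.mul_rpow ht.1 (norm_nonneg _)] at h2
      refine h1.trans ((mul_le_mul_of_nonneg_right h2 (norm_nonneg _)).trans (le_of_eq ?_))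
      rw [Real.rpow_add_one' (norm_nonneg _) (by linarith), add_sub_cancel_right]
      have : a + 1 ≠ 0 := by linarith
      field_simp) (Set.right_mem_Icc.2 zero_le_one)
  simpa [hd] using key

theorem hessian_taylor_residual_bound
    {E : Type*} [NormedAddCommGroup E] [InnerProductSpace ℝ E] [FiniteDimensional ℝ E]
    (f : E → ℝ) (p : ℕ) (hp : 2 ≤ p) (ν H : ℝ) (hν : ν ∈ Set.Icc (0:ℝ) 1) (hH : 0 ≤ H)
    (hf : ContDiff ℝ p f)
    (hHol : ∀ x y : E, ‖iteratedFDeriv ℝ p f x - iteratedFDeriv ℝ p f y‖ ≤ H * ‖x - y‖ ^ ν) :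
    ∀ x y : E, ‖iteratedFDeriv ℝ 2 f y - iteratedFDeriv ℝ 2 (fun z => taylorPoly f p x z) y‖ ≤
      H / ((p - 2).factorial : ℝ) * ‖y - x‖ ^ ((p : ℝ) + ν - 2) := by
  intro x y
  have hT : ContDiff ℝ p (fun z => taylorPoly f p x z) := by
    unfold taylorPoly
    refine contDiff_const.add (ContDiff.sum fun i _ => contDiff_const.mul ?_)
    exact (iteratedFDeriv ℝ i f x).contDiff.comp
      (contDiff_pi.2 fun _ => contDiff_id.sub contDiff_const)
  have main : ∀ j : ℕ, j ≤ p → ∀ z, ‖iteratedFDeriv ℝ (p - j) f z -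
      iteratedFDeriv ℝ (p - j) (fun z => taylorPoly f p x z) z‖ ≤
      H / (j.factorial : ℝ) * ‖z - x‖ ^ ((j : ℝ) + ν) := by
    intro j
    induction j with
    | zero =>
      intro _ z
      simp only [Nat.sub_zero]
      rw [iteratedFDeriv_taylorPoly_top f p x hf z]
      simpa using hHol z x
    | succ j ih =>
      intro hj z
      have ih := ih (by omega)
      obtain ⟨k, hk⟩ : ∃ k, k = p - (j + 1) := ⟨_, rfl⟩
      rw [← hk]
      rw [show p - j = k + 1 by omega] at ih
      have hkp : ((k : ℕ) : WithTop ℕ∞) < p := by exact_mod_cast (by omega : k < p)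
      have hk1 : ((k + 1 : ℕ) : WithTop ℕ∞) ≤ p := by exact_mod_cast (by omega : k + 1 ≤ p)
      have hd1 := hf.differentiable_iteratedFDeriv hkp
      have hd2 := hT.differentiable_iteratedFDeriv hkp
      have hν0 := hν.1
      have hstep := taylor_int_step (fun z => iteratedFDeriv ℝ k f z -
        iteratedFDeriv ℝ k (fun z => taylorPoly f p x z) z) _ x (H / (j.factorial : ℝ))
        ((j : ℝ) + ν) (by positivity)
        (fun z => (hd1 z).hasFDerivAt.sub (hd2 z).hasFDerivAt)
        (by simp [iteratedFDeriv_taylorPoly_self f p x hf k (by omega)])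
        (by
          intro z
          refine le_trans (le_of_eq ?_) (ih z)
          exact (LinearIsometryEquiv.norm_map (continuousMultilinearCurryLeftEquiv ℝ
            (fun _ : Fin (k + 1) => E) ℝ).symm _).symm) z
      refine hstep.trans ?_
      have e : (j : ℝ) + ν + 1 = ((j + 1 : ℕ) : ℝ) + ν := by push_cast; ring
      rw [e]
      refine mul_le_mul_of_nonneg_right ?_ (by positivity)
      rw [div_div, Nat.factorial_succ]
      push_cast
      refine div_le_div_of_nonneg_left hH (by positivity) ?_
      have : (0 : ℝ) < j.factorial := by positivity
      nlinarith
  have := main (p - 2) (by omega) y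
  rw [show p - (p - 2) = 2 by omega, Nat.cast_sub hp] at this
  rw [show (p : ℝ) + ν - 2 = (p : ℝ) - (2 : ℕ) + ν by push_cast; ring]
  exact this
end

section
/- Let f : E → ℝ be a convex, p-times continuously differentiable function (p ≥ 2) whose p-th derivative is ν-Hölder continuous with constant H_{f,p}(ν). Then for every x,y ∈ E and every u ∈ E, ⟨∇²f(y)u, u⟩ ≤ ⟨∇²Φ_{x,p}(y)u, u⟩ + (H_{f,p}(ν)/(p−2)!)·‖y−x‖^{p+ν−2}·‖u‖², i.e. ∇²f(y) ⪯ ∇²Φ_{x,p}(y) + (H_{f,p}(ν)/(p−2)!)·‖y−x‖^{p+ν−2}·I. -/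
section Helpers
open Function

variable {E : Type*} [NormedAddCommGroup E] [NormedSpace ℝ E]
  {F : Type*} [NormedAddCommGroup F] [NormedSpace ℝ F]

lemma hlb_fderiv_apply {n : ℕ} {f : E → F} (hf : ContDiff ℝ (n + 1 : ℕ) f) (x a : E)
    (c : Fin n → E) :
    (fderiv ℝ (iteratedFDeriv ℝ n f) x a) c = fderiv ℝ (fun y => iteratedFDeriv ℝ n f y c) x a := by
  have hd : DifferentiableAt ℝ (iteratedFDeriv ℝ n f) x :=
    (hf.differentiable_iteratedFDeriv (by exact_mod_cast Nat.lt_succ_self n)) x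
  have := (ContinuousMultilinearMap.apply ℝ (fun _ : Fin n => E) F c).hasFDerivAt.comp x
    hd.hasFDerivAt
  have h2 := this.fderiv
  have h3 : (fun y => iteratedFDeriv ℝ n f y c) =
    (ContinuousMultilinearMap.apply ℝ (fun _ : Fin n => E) F c) ∘ (iteratedFDeriv ℝ n f) := by
    ext y; simp
  rw [h3, h2]; simp

lemma hlb_swap {n : ℕ} {f : E → F} (hf : ContDiff ℝ (n + 2 : ℕ) f) (x a b : E)
    (c : Fin n → E) :
    iteratedFDeriv ℝ (n + 2) f x (Fin.cons a (Fin.cons b c)) =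
      iteratedFDeriv ℝ (n + 2) f x (Fin.cons b (Fin.cons a c)) := by
  have key : ∀ a b : E, iteratedFDeriv ℝ (n + 2) f x (Fin.cons a (Fin.cons b c)) =
      (fderiv ℝ (fderiv ℝ (iteratedFDeriv ℝ n f)) x a b) c := by
    intro a b
    have h1 : ContDiff ℝ (1 + 1 : ℕ) (iteratedFDeriv ℝ n f) := by
      apply hf.iteratedFDeriv_right
      norm_cast; omega
    have h2 : ContDiff ℝ 1 (fderiv ℝ (iteratedFDeriv ℝ n f)) :=
      h1.fderiv_right (by norm_cast)
    have hd : DifferentiableAt ℝ (fderiv ℝ (iteratedFDeriv ℝ n f)) x :=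
      h2.differentiable (by norm_num) x
    rw [iteratedFDeriv_succ_apply_left]
    simp only [Fin.cons_zero, Fin.tail_cons]
    rw [hlb_fderiv_apply hf]
    have hb : HasFDerivAt (fun y => fderiv ℝ (iteratedFDeriv ℝ n f) y b)
        ((fderiv ℝ (fderiv ℝ (iteratedFDeriv ℝ n f)) x).flip b) x := by
      simpa using hd.hasFDerivAt.clm_apply (hasFDerivAt_const b x)
    have h4 := ((ContinuousMultilinearMap.apply ℝ (fun _ : Fin n => E) F c).hasFDerivAt.comp x
      hb).fderiv
    have h3 : (fun y => iteratedFDeriv ℝ (n + 1) f y (Fin.cons b c)) =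
      (ContinuousMultilinearMap.apply ℝ (fun _ : Fin n => E) F c) ∘
        (fun y => fderiv ℝ (iteratedFDeriv ℝ n f) y b) := by
      ext y
      rw [iteratedFDeriv_succ_apply_left]; simp
    rw [h3, h4]
    simp
  rw [key, key]
  have h1 : ContDiffAt ℝ 2 (iteratedFDeriv ℝ n f) x := by
    apply ContDiff.contDiffAt
    apply hf.iteratedFDeriv_right
    norm_cast; omega
  have := h1.isSymmSndFDerivAt (by simp)
  rw [this a b]

lemma hlb_symm (n : ℕ) {f : E → F} (hf : ContDiff ℝ (n + 1 : ℕ) f) (x w v : E) (j : Fin (n + 1)) :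
    iteratedFDeriv ℝ (n + 1) f x (update (fun _ => w) j v) =
      iteratedFDeriv ℝ (n + 1) f x (update (fun _ => w) (Fin.last n) v) := by
  induction n generalizing x with
  | zero =>
    rw [show j = Fin.last 0 from Subsingleton.elim (α := Fin 1) _ _]
  | succ n ih =>
    have hs : ∀ i : Fin (n + 1), iteratedFDeriv ℝ (n + 2) f x (update (fun _ => w) i.succ v) =
        iteratedFDeriv ℝ (n + 2) f x (update (fun _ => w) (Fin.last (n+1)) v) := by
      have h0 : ∀ i : Fin (n + 1), iteratedFDeriv ℝ (n + 2) f x (update (fun _ => w) i.succ v) =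
          fderiv ℝ (fun y => iteratedFDeriv ℝ (n+1) f y (update (fun _ => w) i v)) x w := by
        intro i
        rw [iteratedFDeriv_succ_apply_left, ← hlb_fderiv_apply hf]
        have e1 : (update (fun _ => w) i.succ v : Fin (n+2) → E) 0 = w := by
          rw [update_of_ne]; exact (Fin.succ_ne_zero i).symm
        rw [e1, Fin.tail_update_succ]
        rfl
      intro i
      rw [h0, ← Fin.succ_last, h0]
      congr 2
      ext y
      exact ih (hf.of_le (by norm_cast; omega)) y i
    refine Fin.cases ?_ hs j
    rw [← hs 0]
    have e1 : (update (fun _ => w) 0 v : Fin (n+2) → E) =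
        Fin.cons v (Fin.cons w (fun _ => w)) := by
      ext i; refine Fin.cases ?_ (fun i => ?_) i
      · simp
      · refine Fin.cases ?_ (fun i => ?_) i
        · simp [update_apply]
        · simp [update_apply]
    have e2 : (update (fun _ => w) (Fin.succ 0) v : Fin (n+2) → E) =
        Fin.cons w (Fin.cons v (fun _ => w)) := by
      ext i; refine Fin.cases ?_ (fun i => ?_) i
      · simp [update_apply]
      · refine Fin.cases ?_ (fun i => ?_) i
        · simp [update_apply]
        · simp [update_apply, Fin.ext_iff]
    rw [e1, e2]
    exact hlb_swap hf x v w _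

/-- vector-valued Taylor polynomial -/
noncomputable def hlbT (f : E → F) (k : ℕ) (x y : E) : F :=
  ∑ i ∈ Finset.range (k + 1), (1 / (i.factorial : ℝ)) • iteratedFDeriv ℝ i f x (fun _ => y - x)

lemma hlb_term (n : ℕ) {f : E → F} (hf : ContDiff ℝ (n + 1 : ℕ) f) (x y : E) :
    HasFDerivAt (fun y => iteratedFDeriv ℝ (n + 1) f x (fun _ => y - x))
      (((n : ℝ) + 1) • iteratedFDeriv ℝ n (fderiv ℝ f) x (fun _ => y - x)) y := by
  have h := HasFDerivAt.multilinear_comp (iteratedFDeriv ℝ (n + 1) f x)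
    (g := fun _ y => y - x) (g' := fun _ => ContinuousLinearMap.id ℝ E) (x := y)
    (fun i => (hasFDerivAt_id y).sub_const x)
  convert h using 1
  ext v
  simp only [ContinuousLinearMap.smul_apply, ContinuousLinearMap.comp_id,
    ContinuousLinearMap.sum_apply]
  have : ∀ i : Fin (n+1), ((iteratedFDeriv ℝ (n + 1) f x).toContinuousLinearMap
      (fun _ => y - x) i) v = iteratedFDeriv ℝ n (fderiv ℝ f) x (fun _ => y - x) v := by
    intro i
    have : ((iteratedFDeriv ℝ (n + 1) f x).toContinuousLinearMap
      (fun _ => y - x) i) v = iteratedFDeriv ℝ (n + 1) f x (update (fun _ => y - x) i v) := rfl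
    rw [this, hlb_symm n hf, iteratedFDeriv_succ_apply_right]
    rw [Fin.init_update_last]
    simp
    rfl
  simp only [this]
  simp [← Nat.cast_smul_eq_nsmul ℝ]

lemma hlb_deriv (k : ℕ) {f : E → F} (hf : ContDiff ℝ (k + 1 : ℕ) f) (x y : E) :
    HasFDerivAt (hlbT f (k + 1) x) (hlbT (fderiv ℝ f) k x y) y := by
  have e : hlbT f (k + 1) x = fun y => (∑ i ∈ Finset.range (k + 1),
      (1 / ((i+1).factorial : ℝ)) • iteratedFDeriv ℝ (i+1) f x (fun _ => y - x)) + f x := by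
    ext y
    unfold hlbT
    rw [Finset.sum_range_succ']
    simp
  rw [e]
  apply HasFDerivAt.add_const
  unfold hlbT
  apply HasFDerivAt.fun_sum
  intro i hi
  have hi' : i ≤ k := by simpa [Nat.lt_succ_iff] using hi
  have := (hlb_term i (hf.of_le (by norm_cast; omega)) x y).const_smul (1 / ((i+1).factorial : ℝ))
  refine this.congr_fderiv ?_
  rw [smul_smul]
  congr 1
  rw [Nat.factorial_succ]
  have := Nat.factorial_ne_zero i
  push_cast
  field_simp

lemma hlb_self (k : ℕ) (f : E → F) (x : E) : hlbT f k x x = f x := by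
  unfold hlbT
  rw [Finset.sum_range_succ']
  simp only [sub_self]
  rw [Finset.sum_eq_zero]
  · simp
  · intro i _
    rw [show (fun _ : Fin (i+1) => (0:E)) = 0 from rfl, ContinuousMultilinearMap.map_zero, smul_zero]

lemma hlb_norm (k : ℕ) (g : E → F) (a b : E) :
    ‖iteratedFDeriv ℝ k (fderiv ℝ g) a - iteratedFDeriv ℝ k (fderiv ℝ g) b‖ =
      ‖iteratedFDeriv ℝ (k + 1) g a - iteratedFDeriv ℝ (k + 1) g b‖ := by
  rw [iteratedFDeriv_succ_eq_comp_right, iteratedFDeriv_succ_eq_comp_right]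
  refine ((continuousMultilinearCurryRightEquiv' ℝ k E F).symm.norm_map _).symm.trans ?_
  rw [LinearIsometryEquiv.map_sub]
  rfl

end Helpers

section Helpers2
universe u

lemma hlb_rem {E : Type u} [NormedAddCommGroup E] [NormedSpace ℝ E] (ν H : ℝ) (hν : 0 ≤ ν)
    (hH : 0 ≤ H) (x y : E) (k : ℕ) :
    ∀ {F : Type u} [NormedAddCommGroup F] [NormedSpace ℝ F] (g : E → F), ContDiff ℝ k g →
    (∀ x y : E, ‖iteratedFDeriv ℝ k g x - iteratedFDeriv ℝ k g y‖ ≤ H * ‖x - y‖ ^ ν) →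
    ∀ t ∈ Set.Icc (0:ℝ) 1, ‖g (x + t • (y - x)) - hlbT g k x (x + t • (y - x))‖ ≤
      H * ‖y - x‖ ^ ν * ‖y - x‖ ^ k * t ^ k / k.factorial := by
  induction k with
  | zero =>
    intro F _ _ g hg hH' t ht
    have h1 := hH' (x + t • (y - x)) x
    have h2 : ‖iteratedFDeriv ℝ 0 g (x + t • (y - x)) - iteratedFDeriv ℝ 0 g x‖ =
        ‖g (x + t • (y - x)) - g x‖ := by
      rw [iteratedFDeriv_zero_eq_comp, Function.comp, Function.comp, ← map_sub,
        LinearIsometryEquiv.norm_map]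
    rw [h2] at h1
    have h3 : hlbT g 0 x (x + t • (y - x)) = g x := by simp [hlbT]
    rw [h3]
    simp only [pow_zero, Nat.factorial_zero, Nat.cast_one, mul_one, div_one]
    refine h1.trans ?_
    gcongr
    rw [add_sub_cancel_left, norm_smul, Real.norm_eq_abs, abs_of_nonneg ht.1]
    exact mul_le_of_le_one_left (norm_nonneg _) ht.2
  | succ k ih =>
    intro F _ _ g hg hH'
    have hg' : ContDiff ℝ k (fderiv ℝ g) := hg.fderiv_right (by norm_cast)
    have ih' := ih (fderiv ℝ g) hg' (by
      intro a b
      refine le_trans (le_of_eq ?_) (hH' a b)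
      exact hlb_norm k g a b)
    have hder : ∀ t : ℝ, HasDerivAt
        (fun t : ℝ => g (x + t • (y - x)) - hlbT g (k+1) x (x + t • (y - x)))
        ((fderiv ℝ g (x + t • (y - x)) - hlbT (fderiv ℝ g) k x (x + t • (y - x))) (y - x)) t := by
      intro t
      have hl : HasDerivAt (fun t : ℝ => x + t • (y - x)) (y - x) t := by
        simpa using ((hasDerivAt_id t).smul_const (y - x)).const_add x
      have hd : HasFDerivAt g (fderiv ℝ g (x + t • (y - x))) (x + t • (y - x)) :=
        (hg.differentiable (by norm_num) _).hasFDerivAt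
      exact (hd.sub (hlb_deriv k hg x _)).comp_hasDerivAt t hl
    intro t ht
    refine image_norm_le_of_norm_deriv_right_le_deriv_boundary
      (B := fun t => H * ‖y - x‖ ^ ν * ‖y - x‖ ^ (k+1) * t ^ (k+1) / (k+1).factorial)
      (B' := fun t => H * ‖y - x‖ ^ ν * ‖y - x‖ ^ (k+1) * (((k+1 : ℕ) : ℝ) * t ^ k)
        / (k+1).factorial)
      (fun t _ => (hder t).continuousAt.continuousWithinAt)
      (fun t _ => (hder t).hasDerivWithinAt) ?_ ?_ ?_ ht
    · simp [hlb_self]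
    · intro t
      have := ((hasDerivAt_pow (k+1) t).const_mul
        (H * ‖y - x‖ ^ ν * ‖y - x‖ ^ (k+1))).div_const ((k+1).factorial : ℝ)
      simpa using this
    · intro t ht
      refine (ContinuousLinearMap.le_opNorm _ _).trans ?_
      refine (mul_le_mul_of_nonneg_right (ih' t ⟨ht.1, ht.2.le⟩) (norm_nonneg _)).trans
        (le_of_eq ?_)
      rw [Nat.factorial_succ]
      have := Nat.factorial_ne_zero k
      push_cast
      field_simp
      ring

end Helpers2

theorem hessian_loewner_bound
    {E : Type*} [NormedAddCommGroup E] [InnerProductSpace ℝ E] [FiniteDimensional ℝ E]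
    (f : E → ℝ) (p : ℕ) (hp : 2 ≤ p) (ν H : ℝ) (hν : ν ∈ Set.Icc (0:ℝ) 1) (hH : 0 ≤ H)
    (hf : ContDiff ℝ p f) (hconv : ConvexOn ℝ Set.univ f)
    (hHol : ∀ x y : E, ‖iteratedFDeriv ℝ p f x - iteratedFDeriv ℝ p f y‖ ≤ H * ‖x - y‖ ^ ν) :
    ∀ x y u : E,
      iteratedFDeriv ℝ 2 f y (fun _ => u) ≤
        iteratedFDeriv ℝ 2 (fun z => taylorPoly f p x z) y (fun _ => u)
          + H / ((p - 2).factorial : ℝ) * ‖y - x‖ ^ ((p : ℝ) + ν - 2) * ‖u‖ ^ 2 := by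
  intro x y u
  obtain ⟨k, rfl⟩ : ∃ k, p = k + 2 := ⟨p - 2, by omega⟩
  have hT : (fun z => taylorPoly f (k + 2) x z) = hlbT f (k + 1 + 1) x := by
    ext z
    unfold taylorPoly hlbT
    rw [Finset.range_eq_Ico, Finset.sum_eq_sum_Ico_succ_bot (by omega)]
    simp
    rfl
  have hf1 : ContDiff ℝ (k + 1 : ℕ) (fderiv ℝ f) := hf.fderiv_right (by norm_cast)
  have hf2 : ContDiff ℝ k (fderiv ℝ (fderiv ℝ f)) := hf1.fderiv_right (by norm_cast)
  have hrem := hlb_rem ν H hν.1 hH x y k (fderiv ℝ (fderiv ℝ f)) hf2 (by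
    intro a b
    refine le_trans (le_of_eq ?_) (hHol a b)
    rw [hlb_norm, hlb_norm]) 1 (by simp)
  have hd1 : fderiv ℝ (hlbT f (k + 1 + 1) x) = hlbT (fderiv ℝ f) (k + 1) x := by
    ext1 z
    exact (hlb_deriv (k+1) hf x z).fderiv
  rw [hT, iteratedFDeriv_two_apply, iteratedFDeriv_two_apply, hd1, (hlb_deriv k hf1 x y).fderiv]
  simp only [one_smul, add_sub_cancel, one_pow, mul_one] at hrem
  set R := fderiv ℝ (fderiv ℝ f) y - hlbT (fderiv ℝ (fderiv ℝ f)) k x y with hR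
  have h1 : R u u ≤ ‖R‖ * ‖u‖ * ‖u‖ := (le_abs_self _).trans (R.le_opNorm₂ u u)
  have h2 : H * ‖y - x‖ ^ ν * ‖y - x‖ ^ k / (k.factorial : ℝ) =
      H / ((k + 2 - 2).factorial : ℝ) * ‖y - x‖ ^ (((k + 2 : ℕ) : ℝ) + ν - 2) := by
    have : ((k + 2 : ℕ) : ℝ) + ν - 2 = ν + k := by push_cast; ring
    rw [this, Real.rpow_add_of_nonneg (norm_nonneg _) hν.1 (by positivity), Real.rpow_natCast]
    simp only [Nat.add_sub_cancel]
    ring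
  rw [← h2]
  have h3 : ‖R‖ * ‖u‖ * ‖u‖ ≤
      H * ‖y - x‖ ^ ν * ‖y - x‖ ^ k / (k.factorial : ℝ) * ‖u‖ ^ 2 := by
    rw [mul_assoc, ← sq]
    gcongr
  have h4 : R u u = fderiv ℝ (fderiv ℝ f) y u u - hlbT (fderiv ℝ (fderiv ℝ f)) k x y u u := by
    simp [hR]
  linarith
end

section
/- Let f : E → ℝ be a convex, p-times continuously differentiable function (p ≥ 2) whose p-th derivative is ν-Hölder continuous with constant H_{f,p}(ν) < ∞. If H ≥ (p−1)·H_{f,p}(ν), then for every fixed x ∈ E the regularized Taylor model Ω(y) = Φ_{x,p}(y) + (H/p!)·‖y−x‖^{p+ν} is a convex function of y. -/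
universe u

open Function in
theorem rtm_symm_step {E F : Type*} [NormedAddCommGroup E] [NormedSpace ℝ E]
    [NormedAddCommGroup F] [NormedSpace ℝ F] (f : E → F) (n : ℕ) (hf : ContDiff ℝ (n + 2 : ℕ) f)
    (x w v : E)
    (ih : ∀ j : Fin (n + 1), iteratedFDeriv ℝ (n + 1) (fderiv ℝ f) x (update (fun _ => w) j v)
      = iteratedFDeriv ℝ n (fderiv ℝ (fderiv ℝ f)) x (fun _ => w) v) (j : Fin (n + 2)) :
    iteratedFDeriv ℝ (n + 2) f x (update (fun _ => w) j v)
      = iteratedFDeriv ℝ (n + 1) (fderiv ℝ f) x (fun _ => w) v := by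
  rw [iteratedFDeriv_succ_apply_right]
  refine Fin.lastCases ?_ (fun i => ?_) j
  · congr 2
    · rw [Fin.init_update_last]; rfl
    · simp
  · rw [Fin.init_update_castSucc]
    have h1 : (Fin.init (fun _ => w) : Fin (n + 1) → E) = fun _ => w := rfl
    rw [h1]
    erw [ih i]
    rw [update_of_ne (Fin.castSucc_lt_last i).ne', iteratedFDeriv_succ_apply_right]
    have h2 : fderiv ℝ (fderiv ℝ f) =
        (ContinuousLinearMap.flipₗᵢ ℝ E E F).toContinuousLinearEquiv ∘ fderiv ℝ (fderiv ℝ f) := by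
      ext y a b
      have := (hf.contDiffAt (x := y)).isSymmSndFDerivAt (by
        simp only [minSmoothness_of_isRCLikeNormedField]; exact_mod_cast Nat.le_add_left 2 n)
      exact this a b
    have h3 := congrArg (fun g : E → E →L[ℝ] E →L[ℝ] F =>
      iteratedFDeriv ℝ n g x (fun _ => w) v w) h2
    have h4 := ContinuousLinearEquiv.iteratedFDeriv_comp_left (𝕜 := ℝ)
      (F := E →L[ℝ] E →L[ℝ] F) (G := E →L[ℝ] E →L[ℝ] F) (f := fderiv ℝ (fderiv ℝ f)) (x := x)
      (ContinuousLinearMap.flipₗᵢ ℝ E E F).toContinuousLinearEquiv (i := n)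
    refine h3.trans ?_
    exact congrArg (fun M : ContinuousMultilinearMap ℝ (fun _ : Fin n => E) (E →L[ℝ] E →L[ℝ] F) =>
      M (fun _ => w) v w) h4

open Function in
theorem rtm_symm_base {E F : Type*} [NormedAddCommGroup E] [NormedSpace ℝ E]
    [NormedAddCommGroup F] [NormedSpace ℝ F] (f : E → F) (x w v : E) (j : Fin 1) :
    iteratedFDeriv ℝ 1 f x (update (fun _ => w) j v)
      = iteratedFDeriv ℝ 0 (fderiv ℝ f) x (fun _ => w) v := by
  have : j = 0 := Subsingleton.elim _ _
  subst this
  simp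

open Function in
theorem rtm_symm_aux {E : Type u} [NormedAddCommGroup E] [NormedSpace ℝ E] (n : ℕ) :
    ∀ {F : Type u} [NormedAddCommGroup F] [NormedSpace ℝ F] (f : E → F)
      (_ : ContDiff ℝ (n + 1 : ℕ) f) (x w v : E) (j : Fin (n + 1)),
    iteratedFDeriv ℝ (n + 1) f x (update (fun _ => w) j v)
      = iteratedFDeriv ℝ n (fderiv ℝ f) x (fun _ => w) v := by
  induction n with
  | zero => intro F _ _ f hf x w v j; exact rtm_symm_base f x w v j
  | succ n ih =>
    intro F _ _ f hf x w v j
    refine rtm_symm_step f n hf x w v (ih _ ?_ x w v) j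
    exact hf.fderiv_right (by exact_mod_cast le_refl _)

open Function in
theorem rtm_symm {E : Type u} [NormedAddCommGroup E] [NormedSpace ℝ E] (n : ℕ)
    (f : E → ℝ) (hf : ContDiff ℝ (n + 1 : ℕ) f) (x w v : E) (j : Fin (n + 1)) :
    iteratedFDeriv ℝ (n + 1) f x (update (fun _ => w) j v)
      = iteratedFDeriv ℝ n (fderiv ℝ f) x (fun _ => w) v := by
  cases n with
  | zero => exact rtm_symm_base f x w v j
  | succ n =>
    refine rtm_symm_step f n hf x w v (rtm_symm_aux n _ ?_ x w v) j
    exact hf.fderiv_right (by exact_mod_cast le_refl _)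

/-- vector valued Taylor polynomial -/
noncomputable def rtmT {E F : Type*} [NormedAddCommGroup E] [NormedSpace ℝ E]
    [NormedAddCommGroup F] [NormedSpace ℝ F] (f : E → F) (p : ℕ) (x y : E) : F :=
  ∑ i ∈ Finset.range (p + 1), (1 / (i.factorial : ℝ)) • iteratedFDeriv ℝ i f x (fun _ => y - x)

open Function in
theorem rtm_term_deriv {E F : Type*} [NormedAddCommGroup E] [NormedSpace ℝ E]
    [NormedAddCommGroup F] [NormedSpace ℝ F] (f : E → F) (n : ℕ) (x y : E)
    (hs : ∀ w v : E, ∀ j : Fin (n + 1),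
      iteratedFDeriv ℝ (n + 1) f x (update (fun _ => w) j v)
      = iteratedFDeriv ℝ n (fderiv ℝ f) x (fun _ => w) v) :
    HasFDerivAt (fun y => (1 / ((n + 1).factorial : ℝ)) •
        iteratedFDeriv ℝ (n + 1) f x (fun _ => y - x))
      ((1 / (n.factorial : ℝ)) • iteratedFDeriv ℝ n (fderiv ℝ f) x (fun _ => y - x)) y := by
  have h0 : HasFDerivAt (fun (z : E) (_ : Fin (n + 1)) => z - x)
      (ContinuousLinearMap.pi fun _ => ContinuousLinearMap.id ℝ E) y :=
    hasFDerivAt_pi.2 fun _ : Fin (n + 1) => (hasFDerivAt_id y).sub_const x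
  have h := HasFDerivAt.comp (f := fun (z : E) (_ : Fin (n + 1)) => z - x) y
    ((iteratedFDeriv ℝ (n + 1) f x).hasFDerivAt (fun _ => y - x)) h0
  refine (h.const_smul (1 / ((n + 1).factorial : ℝ))).congr_fderiv ?_
  ext v
  simp only [smul_apply, ContinuousLinearMap.comp_apply,
    ContinuousMultilinearMap.linearDeriv_apply, ContinuousLinearMap.pi_apply,
    ContinuousLinearMap.id_apply, hs, Finset.sum_const, Finset.card_univ, Fintype.card_fin]
  rw [← Nat.cast_smul_eq_nsmul ℝ, smul_smul]
  congr 1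
  rw [Nat.factorial_succ]
  push_cast
  field_simp

open Function in
theorem rtmT_deriv {E F : Type*} [NormedAddCommGroup E] [NormedSpace ℝ E]
    [NormedAddCommGroup F] [NormedSpace ℝ F] (f : E → F) (p : ℕ) (x y : E)
    (hs : ∀ n ≤ p, ∀ w v : E, ∀ j : Fin (n + 1),
      iteratedFDeriv ℝ (n + 1) f x (update (fun _ => w) j v)
      = iteratedFDeriv ℝ n (fderiv ℝ f) x (fun _ => w) v) :
    HasFDerivAt (rtmT f (p + 1) x) (rtmT (fderiv ℝ f) p x y) y := by
  have h := HasFDerivAt.fun_sum (u := Finset.range (p + 1)) (fun i hi =>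
    rtm_term_deriv f i x y (hs i (by simpa [Nat.lt_succ_iff] using hi)))
  have h' := h.add_const (f x)
  refine (h'.congr_of_eventuallyEq (Filter.Eventually.of_forall fun z => ?_))
  simp only [rtmT]
  rw [Finset.sum_range_succ']
  simp

theorem rtm_norm_sub {E F : Type*} [NormedAddCommGroup E] [NormedSpace ℝ E]
    [NormedAddCommGroup F] [NormedSpace ℝ F] (f : E → F) (n : ℕ) (x z : E) :
    ‖iteratedFDeriv ℝ n (fderiv ℝ f) z - iteratedFDeriv ℝ n (fderiv ℝ f) x‖ =
    ‖iteratedFDeriv ℝ (n + 1) f z - iteratedFDeriv ℝ (n + 1) f x‖ := by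
  rw [iteratedFDeriv_succ_eq_comp_right, iteratedFDeriv_succ_eq_comp_right,
    Function.comp_apply, Function.comp_apply]
  refine ((continuousMultilinearCurryRightEquiv' ℝ n E F).symm.norm_map _).symm.trans ?_
  exact congrArg norm (LinearIsometryEquiv.map_sub _ _ _)

theorem rtm_remainder {E : Type u} [NormedAddCommGroup E] [NormedSpace ℝ E] (x : E) (n : ℕ) :
    ∀ {F : Type u} [NormedAddCommGroup F] [NormedSpace ℝ F] (f : E → F)
      (_ : ContDiff ℝ n f) (C r : ℝ) (_ : ∀ z, ‖z - x‖ ≤ r →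
        ‖iteratedFDeriv ℝ n f z - iteratedFDeriv ℝ n f x‖ ≤ C) (y : E) (_ : ‖y - x‖ ≤ r),
    ‖f y - rtmT f n x y‖ ≤ C * ‖y - x‖ ^ n / n.factorial := by
  induction n with
  | zero =>
    intro F _ _ f hf C r hC y hy
    have := hC y hy
    rw [iteratedFDeriv_zero_eq_comp, Function.comp_apply, Function.comp_apply, ← map_sub,
      LinearIsometryEquiv.norm_map] at this
    simpa [rtmT] using this
  | succ n ih =>
    intro F _ _ f hf C r hC y hy
    have hf' : ContDiff ℝ n (fderiv ℝ f) := hf.fderiv_right (by exact_mod_cast le_refl _)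
    have hb := ih (fderiv ℝ f) hf' C r (fun z hz => (rtm_norm_sub f n x z).trans_le (hC z hz))
    have hR : ∀ z, HasFDerivAt (fun z => f z - rtmT f (n + 1) x z)
        (fderiv ℝ f z - rtmT (fderiv ℝ f) n x z) z := fun z =>
      ((hf.differentiable (by simp)) z).hasFDerivAt.sub
        (rtmT_deriv f n x z fun k hk w v j => rtm_symm_aux k f
          (hf.of_le (by exact_mod_cast Nat.succ_le_succ hk)) x w v j)
    have hl : ∀ t : ℝ, HasDerivAt (fun t : ℝ => x + t • (y - x)) (y - x) t := fun t => by
      simpa using ((hasDerivAt_id t).smul_const (y - x)).const_add x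
    have hc : ∀ t : ℝ, HasDerivAt
        (fun t : ℝ => f (x + t • (y - x)) - rtmT f (n + 1) x (x + t • (y - x)))
        ((fderiv ℝ f (x + t • (y - x)) - rtmT (fderiv ℝ f) n x (x + t • (y - x))) (y - x)) t :=
      fun t => HasFDerivAt.comp_hasDerivAt (f := fun t : ℝ => x + t • (y - x)) t
        (hR (x + t • (y - x))) (hl t)
    have key := image_norm_le_of_norm_deriv_right_le_deriv_boundary (a := 0) (b := 1)
      (B := fun t => C * ‖y - x‖ ^ (n + 1) / (n + 1).factorial * t ^ (n + 1))
      (B' := fun t => C * ‖y - x‖ ^ (n + 1) / (n + 1).factorial * (((n + 1 : ℕ) : ℝ) * t ^ n))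
      (fun t _ => (hc t).continuousAt.continuousWithinAt)
      (fun t _ => (hc t).hasDerivWithinAt) ?_ ?_ ?_ (Set.right_mem_Icc.2 zero_le_one)
    · simpa using key
    · simp [rtmT, Finset.sum_range_succ', ← Pi.zero_def]
    · intro t
      simpa using (hasDerivAt_pow (n + 1) t).const_mul (C * ‖y - x‖ ^ (n + 1) / (n + 1).factorial)
    · intro t ht
      refine (ContinuousLinearMap.le_opNorm _ _).trans ?_
      have hnorm : ‖x + t • (y - x) - x‖ = t * ‖y - x‖ := by
        rw [add_sub_cancel_left, norm_smul, Real.norm_of_nonneg ht.1]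
      have h1 := hb (x + t • (y - x)) (by
        rw [hnorm]; nlinarith [norm_nonneg (y - x), ht.2])
      rw [hnorm] at h1
      refine (mul_le_mul_of_nonneg_right h1 (norm_nonneg _)).trans (le_of_eq ?_)
      rw [Nat.factorial_succ]
      push_cast
      field_simp
      ring

theorem rtm_line {E : Type u} [NormedAddCommGroup E] [InnerProductSpace ℝ E]
    (f : E → ℝ) (m : ℕ) (ν Hf H : ℝ) (hν0 : 0 ≤ ν) (hHf : 0 ≤ Hf)
    (hf : ContDiff ℝ (m + 2 : ℕ) f)
    (hHol : ∀ x y : E, ‖iteratedFDeriv ℝ (m + 2) f x - iteratedFDeriv ℝ (m + 2) f y‖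
      ≤ Hf * ‖x - y‖ ^ ν)
    (hH : ((m : ℝ) + 1) * Hf ≤ H) (x a v : E) (ε : ℝ) (hε : 0 < ε) :
    ConvexOn ℝ Set.univ (fun t : ℝ => rtmT f (m + 2) x (a + t • v) - f (a + t • v)
      + H / ((m + 2).factorial : ℝ) *
        (‖a + t • v - x‖ ^ 2 + ε) ^ (((m : ℝ) + 2 + ν) / 2)) := by
  have hf1 : ContDiff ℝ (m + 1 : ℕ) (fderiv ℝ f) := hf.fderiv_right (by exact_mod_cast le_refl _)
  have hf2 : ContDiff ℝ m (fderiv ℝ (fderiv ℝ f)) :=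
    hf1.fderiv_right (by exact_mod_cast le_refl _)
  have hl : ∀ t : ℝ, HasDerivAt (fun t : ℝ => a + t • v) v t := fun t => by
    simpa using ((hasDerivAt_id t).smul_const v).const_add a
  have hR1 : ∀ z, HasFDerivAt (fun z => rtmT f (m + 2) x z - f z)
      (rtmT (fderiv ℝ f) (m + 1) x z - fderiv ℝ f z) z := fun z =>
    (rtmT_deriv f (m + 1) x z fun k hk w v j => rtm_symm k f
        (hf.of_le (by exact_mod_cast Nat.succ_le_succ hk)) x w v j).sub
    ((hf.differentiable (by simp)) z).hasFDerivAt
  have hR2 : ∀ z, HasFDerivAt (fun z => rtmT (fderiv ℝ f) (m + 1) x z - fderiv ℝ f z)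
      (rtmT (fderiv ℝ (fderiv ℝ f)) m x z - fderiv ℝ (fderiv ℝ f) z) z := fun z =>
    (rtmT_deriv (fderiv ℝ f) m x z fun k hk w v j => rtm_symm_aux k (fderiv ℝ f)
        (hf1.of_le (by exact_mod_cast Nat.succ_le_succ hk)) x w v j).sub
    ((hf1.differentiable (by simp)) z).hasFDerivAt
  have hg1 : ∀ t : ℝ, HasDerivAt (fun t : ℝ => rtmT f (m + 2) x (a + t • v) - f (a + t • v))
      ((rtmT (fderiv ℝ f) (m + 1) x (a + t • v) - fderiv ℝ f (a + t • v)) v) t := fun t =>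
    HasFDerivAt.comp_hasDerivAt (f := fun t : ℝ => a + t • v) t (hR1 (a + t • v)) (hl t)
  have hg2 : ∀ t : ℝ, HasDerivAt
      (fun t : ℝ => (rtmT (fderiv ℝ f) (m + 1) x (a + t • v) - fderiv ℝ f (a + t • v)) v)
      ((rtmT (fderiv ℝ (fderiv ℝ f)) m x (a + t • v)
        - fderiv ℝ (fderiv ℝ f) (a + t • v)) v v) t := fun t => by
    have h := HasFDerivAt.comp_hasDerivAt (f := fun t : ℝ => a + t • v) t (hR2 (a + t • v)) (hl t)
    simpa using h.clm_apply (hasDerivAt_const t v)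
  have hi : ∀ t : ℝ, HasDerivAt (fun t : ℝ => inner ℝ (a + t • v - x) v) (‖v‖ ^ 2) t := fun t => by
    have h := ((hl t).sub_const x).inner ℝ (hasDerivAt_const t v)
    simpa using h
  have hs : ∀ t : ℝ, HasDerivAt (fun t : ℝ => ‖a + t • v - x‖ ^ 2 + ε)
      (2 * inner ℝ (a + t • v - x) v) t := fun t =>
    (((hl t).sub_const x).norm_sq).add_const ε
  have hpos : ∀ t : ℝ, 0 < ‖a + t • v - x‖ ^ 2 + ε := fun t => by positivity
  set K := H / ((m + 2).factorial : ℝ) with hK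
  set e := ((m : ℝ) + 2 + ν) / 2 with he
  have hm0 : (0 : ℝ) ≤ m := Nat.cast_nonneg m
  have hH0 : 0 ≤ H := le_trans (by positivity) hH
  have hK0 : 0 ≤ K := by positivity
  have he1 : 1 ≤ e := by rw [he]; linarith
  have hn1 : ∀ t : ℝ, HasDerivAt (fun t : ℝ => K * (‖a + t • v - x‖ ^ 2 + ε) ^ e)
      (K * (2 * inner ℝ (a + t • v - x) v * e * (‖a + t • v - x‖ ^ 2 + ε) ^ (e - 1))) t :=
    fun t => ((hs t).rpow_const (Or.inl (hpos t).ne')).const_mul K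
  have hn2 : ∀ t : ℝ, HasDerivAt
      (fun t : ℝ => K * (2 * inner ℝ (a + t • v - x) v * e * (‖a + t • v - x‖ ^ 2 + ε) ^ (e - 1)))
      (K * (2 * ‖v‖ ^ 2 * e * (‖a + t • v - x‖ ^ 2 + ε) ^ (e - 1)
        + 2 * inner ℝ (a + t • v - x) v * e * (2 * inner ℝ (a + t • v - x) v * (e - 1)
          * (‖a + t • v - x‖ ^ 2 + ε) ^ (e - 1 - 1)))) t :=
    fun t => ((((hi t).const_mul 2).mul_const e).mul
      ((hs t).rpow_const (Or.inl (hpos t).ne'))).const_mul K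
  refine convexOn_of_hasDerivWithinAt2_nonneg convex_univ
    (fun t _ => ((hg1 t).add (hn1 t)).continuousAt.continuousWithinAt)
    (fun t _ => ((hg1 t).add (hn1 t)).hasDerivWithinAt)
    (fun t _ => ((hg2 t).add (hn2 t)).hasDerivWithinAt) (fun t _ => ?_)
  set y := a + t • v with hy
  set r := ‖y - x‖ with hr
  have hr0 : 0 ≤ r := norm_nonneg _
  have hrem : ‖fderiv ℝ (fderiv ℝ f) y - rtmT (fderiv ℝ (fderiv ℝ f)) m x y‖
      ≤ (Hf * r ^ ν) * r ^ m / m.factorial := by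
    refine rtm_remainder x m _ hf2 (Hf * r ^ ν) r (fun z hz => ?_) y le_rfl
    rw [rtm_norm_sub, rtm_norm_sub]
    refine (hHol z x).trans ?_
    gcongr
  have hlow : -((Hf * r ^ ν) * r ^ m / m.factorial * ‖v‖ * ‖v‖) ≤
      (rtmT (fderiv ℝ (fderiv ℝ f)) m x y - fderiv ℝ (fderiv ℝ f) y) v v := by
    refine (abs_le.1 ?_).1
    rw [← Real.norm_eq_abs]
    refine (ContinuousLinearMap.le_opNorm₂ _ _ _).trans ?_
    have hrem' := (norm_sub_rev (rtmT (fderiv ℝ (fderiv ℝ f)) m x y)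
      (fderiv ℝ (fderiv ℝ f) y)).trans_le hrem
    gcongr
  have hpow : r ^ ν * r ^ m ≤ (r ^ 2 + ε) ^ (e - 1) := by
    have h1 : r ^ ν * r ^ m = (r ^ 2) ^ (e - 1) := by
      rw [← Real.rpow_natCast r m, ← Real.rpow_natCast r 2, ← Real.rpow_mul hr0,
        ← Real.rpow_add_of_nonneg hr0 hν0 hm0]
      congr 1
      rw [he]; push_cast; ring
    rw [h1]
    exact Real.rpow_le_rpow (by positivity) (by linarith) (by linarith)
  have hKe : Hf / m.factorial ≤ K * (2 * e) := by
    have h2 : ((m + 2).factorial : ℝ) = (m + 2) * ((m + 1) * m.factorial) := by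
      rw [Nat.factorial_succ, Nat.factorial_succ]; push_cast; ring
    have hfac : (0 : ℝ) < m.factorial := by exact_mod_cast Nat.factorial_pos m
    rw [hK, h2, he, div_mul_eq_mul_div, div_le_div_iff₀ hfac (by positivity)]
    have h3 : Hf * ((m + 2) * (m + 1)) ≤ H * (2 * (((m : ℝ) + 2 + ν) / 2)) := by
      nlinarith [mul_nonneg hH0 hν0]
    nlinarith
  have hq : 0 ≤ (r ^ 2 + ε) ^ (e - 1 - 1) := Real.rpow_nonneg (hpos t).le _
  have h5 : Hf / m.factorial * (r ^ ν * r ^ m) ≤ K * (2 * e) * (r ^ 2 + ε) ^ (e - 1) := by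
    have : 0 ≤ r ^ ν := Real.rpow_nonneg hr0 _
    gcongr
  have h6 := mul_le_mul_of_nonneg_right h5 (sq_nonneg ‖v‖)
  have h7 : 0 ≤ K * (2 * inner ℝ (y - x) v * e * (2 * inner ℝ (y - x) v * (e - 1)
          * (r ^ 2 + ε) ^ (e - 1 - 1))) := by
    have : K * (2 * inner ℝ (y - x) v * e * (2 * inner ℝ (y - x) v * (e - 1)
          * (r ^ 2 + ε) ^ (e - 1 - 1))) = K * ((2 * inner ℝ (y - x) v) ^ 2 * (e * (e - 1)
          * (r ^ 2 + ε) ^ (e - 1 - 1))) := by ring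
    rw [this]
    have : 0 ≤ e - 1 := by linarith
    positivity
  have h8 : (Hf * r ^ ν) * r ^ m / m.factorial * ‖v‖ * ‖v‖
      = Hf / m.factorial * (r ^ ν * r ^ m) * ‖v‖ ^ 2 := by ring
  rw [h8] at hlow
  rw [mul_add]
  linarith

theorem regularized_taylor_model_convex
    {E : Type*} [NormedAddCommGroup E] [InnerProductSpace ℝ E] [FiniteDimensional ℝ E]
    (f : E → ℝ) (p : ℕ) (hp : 2 ≤ p) (ν Hf H : ℝ) (hν : ν ∈ Set.Icc (0:ℝ) 1) (hHf : 0 ≤ Hf)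
    (hf : ContDiff ℝ p f) (hconv : ConvexOn ℝ Set.univ f)
    (hHol : ∀ x y : E, ‖iteratedFDeriv ℝ p f x - iteratedFDeriv ℝ p f y‖ ≤ Hf * ‖x - y‖ ^ ν)
    (hH : ((p : ℝ) - 1) * Hf ≤ H) (x : E) :
    ConvexOn ℝ Set.univ
      (fun y => taylorPoly f p x y + H / (p.factorial : ℝ) * ‖y - x‖ ^ ((p : ℝ) + ν)) := by
  obtain ⟨m, rfl⟩ : ∃ m, p = m + 2 := ⟨p - 2, by omega⟩
  have hH' : ((m : ℝ) + 1) * Hf ≤ H := by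
    refine le_trans (le_of_eq ?_) hH
    push_cast; ring
  have hT : ∀ y, taylorPoly f (m + 2) x y = rtmT f (m + 2) x y := fun y => by
    rw [taylorPoly, rtmT, Finset.range_eq_Ico, Finset.sum_eq_sum_Ico_succ_bot (by omega)]
    simp only [smul_eq_mul]
    congr 1
    simp
  have hlim : ∀ y, Filter.Tendsto (fun ε : ℝ => rtmT f (m + 2) x y - f y
      + H / ((m + 2).factorial : ℝ) * (‖y - x‖ ^ 2 + ε) ^ (((m : ℝ) + 2 + ν) / 2))
      (nhdsWithin 0 (Set.Ioi 0)) (nhds (rtmT f (m + 2) x y - f y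
      + H / ((m + 2).factorial : ℝ) * ‖y - x‖ ^ (((m + 2 : ℕ) : ℝ) + ν))) := fun y => by
    have he0 : 0 ≤ ((m : ℝ) + 2 + ν) / 2 := by
      have := hν.1
      positivity
    have h1 : ‖y - x‖ ^ (((m + 2 : ℕ) : ℝ) + ν) = (‖y - x‖ ^ 2 + 0) ^ (((m : ℝ) + 2 + ν) / 2) := by
      rw [add_zero, ← Real.rpow_natCast ‖y - x‖ 2, ← Real.rpow_mul (norm_nonneg _)]
      congr 1
      push_cast; ring
    rw [h1]
    refine tendsto_nhdsWithin_of_tendsto_nhds ?_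
    refine tendsto_const_nhds.add (tendsto_const_nhds.mul ?_)
    exact ((tendsto_const_nhds.add Filter.tendsto_id).rpow_const (Or.inr he0))
  have hg : ConvexOn ℝ Set.univ (fun y => rtmT f (m + 2) x y - f y
      + H / ((m + 2).factorial : ℝ) * ‖y - x‖ ^ (((m + 2 : ℕ) : ℝ) + ν)) := by
    refine ⟨convex_univ, fun a _ b _ s t hs ht hst => ?_⟩
    refine le_of_tendsto_of_tendsto (hlim _)
      (((hlim a).const_smul s).add ((hlim b).const_smul t)) ?_
    filter_upwards [self_mem_nhdsWithin] with ε hε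
    have h := (rtm_line f m ν Hf H hν.1 hHf hf hHol hH' x a (b - a) ε hε).2
      (Set.mem_univ 0) (Set.mem_univ 1) hs ht hst
    have e1 : a + (s • (0 : ℝ) + t • (1 : ℝ)) • (b - a) = s • a + t • b := by
      have : s = 1 - t := by linarith
      subst this
      simp only [smul_eq_mul, mul_zero, mul_one, zero_add]
      module
    simp only [e1, zero_smul, one_smul, add_zero, add_sub_cancel] at h
    exact h
  have := hg.add hconv
  refine this.congr fun y _ => ?_
  simp only [Pi.add_apply, hT]
  ring
end

section
/- Fix p ≥ 1, ν ∈ [0,1], and x₀ ∈ E. The function d(x) = ‖x − x₀‖^{p+ν} on a Euclidean space E has ν-Hölder continuous p-th derivative with constant C_{p,ν} = 2·∏_{i=1}^{p}(ν+i), i.e. ‖D^p d(x) − D^p d(y)‖ ≤ C_{p,ν}‖x−y‖^ν for all x,y ∈ E. -/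
open MeasureTheory
open scoped ContDiff

/-- signed power -/
noncomputable def sgnPow (r : ℝ) (k : ℕ) (t : ℝ) : ℝ := (Real.sign t) ^ k * |t| ^ r

lemma abs_sgnPow_le (r : ℝ) (k : ℕ) (t : ℝ) : |sgnPow r k t| ≤ |t| ^ r := by
  unfold sgnPow
  rw [abs_mul, abs_pow, abs_of_nonneg (Real.rpow_nonneg (abs_nonneg t) r)]
  have h : |Real.sign t| ≤ 1 := by
    rcases Real.sign_apply_eq t with h | h | h <;> rw [h] <;> norm_num
  have := pow_le_one₀ (n := k) (abs_nonneg _) h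
  exact mul_le_of_le_one_left (Real.rpow_nonneg (abs_nonneg t) r) this

lemma sgnPow_pos (r : ℝ) (k : ℕ) {t : ℝ} (ht : 0 < t) : sgnPow r k t = t ^ r := by
  simp [sgnPow, Real.sign_of_pos ht, abs_of_pos ht]

lemma sgnPow_neg (r : ℝ) (k : ℕ) {t : ℝ} (ht : t < 0) : sgnPow r k t = (-1) ^ k * (-t) ^ r := by
  simp [sgnPow, Real.sign_of_neg ht, abs_of_neg ht]

lemma sgnPow_zero (r : ℝ) (hr : 0 < r) (k : ℕ) : sgnPow r k 0 = 0 := by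
  simp [sgnPow, Real.zero_rpow hr.ne']

lemma hasDerivAt_sgnPow (r : ℝ) (hr : 1 < r) (k : ℕ) (t : ℝ) :
    HasDerivAt (sgnPow r k) (r * sgnPow (r - 1) (k + 1) t) t := by
  rcases lt_trichotomy t 0 with ht | ht | ht
  · rw [sgnPow_neg _ _ ht]
    have h1 : HasDerivAt (fun s : ℝ => (-1) ^ k * (-s) ^ r) ((-1) ^ k * ((-1) * r * (-t) ^ (r - 1))) t :=
      ((hasDerivAt_id t).neg.rpow_const (Or.inr hr.le)).const_mul _
    have h2 : sgnPow r k =ᶠ[nhds t] (fun s : ℝ => (-1) ^ k * (-s) ^ r) := by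
      filter_upwards [Iio_mem_nhds ht] with s hs
      exact sgnPow_neg r k hs
    refine (h1.congr_of_eventuallyEq h2).congr_deriv ?_
    ring
  · subst ht
    rw [sgnPow_zero _ (by linarith), mul_zero]
    rw [hasDerivAt_iff_isLittleO_nhds_zero]
    simp only [zero_add, sgnPow_zero r (by linarith) k, smul_zero, sub_zero]
    have h0 : (sgnPow r k) =O[nhds 0] (fun t : ℝ => |t| ^ r) := by
      refine Asymptotics.IsBigO.of_bound 1 (Filter.Eventually.of_forall fun s => ?_)
      rw [one_mul, Real.norm_eq_abs, Real.norm_eq_abs]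
      exact (abs_sgnPow_le r k s).trans (le_abs_self _)
    refine h0.trans_isLittleO ?_
    have h1 : HasDerivAt (fun x : ℝ => |x| ^ r) (r * |(0:ℝ)| ^ (r - 2) * 0) 0 := hasDerivAt_abs_rpow 0 hr
    rw [hasDerivAt_iff_isLittleO_nhds_zero] at h1
    simpa [Real.zero_rpow (by linarith : r ≠ 0)] using h1
  · rw [sgnPow_pos _ _ ht]
    have h1 : HasDerivAt (fun s : ℝ => s ^ r) (r * t ^ (r - 1)) t :=
      Real.hasDerivAt_rpow_const (Or.inr hr.le)
    have h2 : sgnPow r k =ᶠ[nhds t] (fun s : ℝ => s ^ r) := by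
      filter_upwards [Ioi_mem_nhds ht] with s hs
      exact sgnPow_pos r k hs
    exact h1.congr_of_eventuallyEq h2

lemma continuous_sgnPow (r : ℝ) (hr : 0 < r) (k : ℕ) : Continuous (sgnPow r k) := by
  rw [continuous_iff_continuousAt]
  intro t
  rcases lt_trichotomy t 0 with ht | ht | ht
  · have h2 : sgnPow r k =ᶠ[nhds t] (fun s : ℝ => (-1) ^ k * (-s) ^ r) := by
      filter_upwards [Iio_mem_nhds ht] with s hs
      exact sgnPow_neg r k hs
    refine ContinuousAt.congr ?_ h2.symm
    exact continuousAt_const.mul (continuousAt_neg.rpow_const (Or.inr hr.le))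
  · subst ht
    unfold ContinuousAt
    rw [sgnPow_zero r hr]
    refine squeeze_zero_norm (a := fun t : ℝ => |t| ^ r) (fun s => abs_sgnPow_le r k s) ?_
    have : Continuous (fun t : ℝ => |t| ^ r) := continuous_abs.rpow_const (fun _ => Or.inr hr.le)
    simpa [Real.zero_rpow hr.ne'] using this.tendsto 0
  · have h2 : sgnPow r k =ᶠ[nhds t] (fun s : ℝ => s ^ r) := by
      filter_upwards [Ioi_mem_nhds ht] with s hs
      exact sgnPow_pos r k hs
    refine ContinuousAt.congr ?_ h2.symm
    exact continuousAt_id.rpow_const (Or.inr hr.le)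

lemma abs_rpow_sub_le {ν : ℝ} (h0 : 0 < ν) (h1 : ν ≤ 1) {a b : ℝ} (ha : 0 < a) (hb : 0 < b) :
    |a ^ ν - b ^ ν| ≤ |a - b| ^ ν := by
  wlog h : b ≤ a generalizing a b
  · rw [abs_sub_comm, abs_sub_comm a]
    exact this hb ha (le_of_not_ge h)
  have h3 := Real.rpow_le_rpow hb.le h h0.le
  rw [abs_of_nonneg (by linarith), abs_of_nonneg (by linarith)]
  have := Real.rpow_add_le_add_rpow (sub_nonneg.2 h) hb.le h0.le h1
  rw [sub_add_cancel] at this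
  linarith

lemma sgnPow_holder {ν : ℝ} (h0 : 0 < ν) (h1 : ν ≤ 1) (k : ℕ) (a b : ℝ) :
    |sgnPow ν k a - sgnPow ν k b| ≤ 2 * |a - b| ^ ν := by
  have hn : 0 ≤ |a - b| ^ ν := Real.rpow_nonneg (abs_nonneg _) _
  by_cases hpos : 0 < a ∧ 0 < b
  · obtain ⟨ha, hb⟩ := hpos
    rw [sgnPow_pos _ _ ha, sgnPow_pos _ _ hb]
    linarith [abs_rpow_sub_le h0 h1 ha hb]
  by_cases hneg : a < 0 ∧ b < 0
  · obtain ⟨ha, hb⟩ := hneg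
    rw [sgnPow_neg _ _ ha, sgnPow_neg _ _ hb, ← mul_sub, abs_mul, abs_pow, abs_neg, abs_one, one_pow,
      one_mul]
    have := abs_rpow_sub_le h0 h1 (neg_pos.2 ha) (neg_pos.2 hb)
    rw [show -a - -b = -(a - b) by ring, abs_neg] at this
    linarith
  have hab : |a| ≤ |a - b| ∧ |b| ≤ |a - b| := by
    rcases le_total a 0 with ha | ha <;> rcases le_total b 0 with hb | hb
    · have : a = 0 ∨ b = 0 := by
        by_contra hc
        push Not at hc
        exact hneg ⟨lt_of_le_of_ne ha hc.1, lt_of_le_of_ne hb hc.2⟩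
      rcases this with h | h <;> subst h <;> simp
    · rw [abs_of_nonpos ha, abs_of_nonneg hb, abs_of_nonpos (by linarith)]
      constructor <;> linarith
    · rw [abs_of_nonneg ha, abs_of_nonpos hb, abs_of_nonneg (by linarith)]
      constructor <;> linarith
    · have : a = 0 ∨ b = 0 := by
        by_contra hc
        push Not at hc
        exact hpos ⟨lt_of_le_of_ne ha hc.1.symm, lt_of_le_of_ne hb hc.2.symm⟩
      rcases this with h | h <;> subst h <;> simp
  have e1 := Real.rpow_le_rpow (abs_nonneg _) hab.1 h0.le
  have e2 := Real.rpow_le_rpow (abs_nonneg _) hab.2 h0.le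
  have e3 := abs_sgnPow_le ν k a
  have e4 := abs_sgnPow_le ν k b
  have e5 := abs_sub (sgnPow ν k a) (sgnPow ν k b)
  linarith

lemma sgnPow_lip (k : ℕ) (a b : ℝ) :
    |sgnPow 1 k a - sgnPow 1 k b| ≤ 1 * |a - b| ^ (1:ℝ) := by
  rw [one_mul, Real.rpow_one]
  rcases Nat.even_or_odd k with hk | hk
  · have : ∀ t, sgnPow 1 k t = |t| := by
      intro t
      rcases lt_trichotomy t 0 with ht | ht | ht
      · rw [sgnPow_neg _ _ ht, hk.neg_one_pow, abs_of_neg ht]; simp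
      · subst ht; simp [sgnPow_zero]
      · rw [sgnPow_pos _ _ ht, abs_of_pos ht]; simp
    rw [this, this]
    exact abs_abs_sub_abs_le a b
  · have : ∀ t, sgnPow 1 k t = t := by
      intro t
      rcases lt_trichotomy t 0 with ht | ht | ht
      · rw [sgnPow_neg _ _ ht, hk.neg_one_pow]; simp
      · subst ht; simp [sgnPow_zero]
      · rw [sgnPow_pos _ _ ht]; simp
    rw [this, this]


lemma exists_good_measure {E : Type*} [NormedAddCommGroup E] [InnerProductSpace ℝ E]
    [FiniteDimensional ℝ E] [MeasurableSpace E] [BorelSpace E] [Nontrivial E] (q : ℝ) (hq : 0 < q) :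
    ∃ μ : Measure E, IsFiniteMeasureOnCompacts μ ∧
      ∀ x : E, ∫ u in Metric.closedBall 0 1, |inner ℝ u x| ^ q ∂μ = ‖x‖ ^ q := by
  obtain ⟨e, he⟩ : ∃ e : E, ‖e‖ = 1 := exists_norm_eq E zero_le_one
  let F : E → ℝ := fun x => ∫ u in Metric.closedBall 0 1, |inner ℝ u x| ^ q
  have hcont : ∀ x : E, Continuous (fun u : E => |inner ℝ u x| ^ q) := fun x =>
    ((continuous_id.inner continuous_const).abs).rpow_const (fun _ => Or.inr hq.le)
  have hinv : ∀ x y : E, ‖x‖ = ‖y‖ → F x = F y := by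
    intro x y hxy
    let R := Submodule.reflection (Submodule.span ℝ {x - y})ᗮ
    have hR : R x = y := Submodule.reflection_sub hxy
    have hmp : MeasurePreserving R := R.measurePreserving
    have h := hmp.setIntegral_preimage_emb R.toHomeomorph.measurableEmbedding
      (fun u => |inner ℝ u y| ^ q) (Metric.closedBall 0 1)
    have hpre : R ⁻¹' (Metric.closedBall 0 1) = Metric.closedBall 0 1 := by
      ext u; simp
    rw [hpre] at h
    change _ = F y at h
    rw [← h, ← hR]
    simp only [LinearIsometryEquiv.inner_map_map]
    rfl
  have hF : ∀ x : E, F x = ‖x‖ ^ q * F e := by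
    intro x
    rw [hinv x (‖x‖ • e) (by simp [norm_smul, he])]
    simp only [F]
    rw [← integral_const_mul]
    congr 1
    ext u
    rw [inner_smul_right, abs_mul, abs_norm, Real.mul_rpow (norm_nonneg _) (abs_nonneg _)]
  have hpos : 0 < F e := by
    simp only [F]
    rw [setIntegral_pos_iff_support_of_nonneg_ae]
    · have hopen : IsOpen (Function.support (fun u : E => |inner ℝ u e| ^ q) ∩ Metric.ball 0 1) :=
        ((hcont e).isOpen_support).inter Metric.isOpen_ball
      refine (hopen.measure_pos volume ⟨(1/2 : ℝ) • e, ?_, ?_⟩).trans_le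
        (measure_mono (Set.inter_subset_inter_right _ Metric.ball_subset_closedBall))
      · rw [Function.mem_support, inner_smul_left, real_inner_self_eq_norm_sq, he]
        apply ne_of_gt
        apply Real.rpow_pos_of_pos
        norm_num
      · simp [norm_smul, he]; norm_num
    · exact Filter.Eventually.of_forall fun u => Real.rpow_nonneg (abs_nonneg _) _
    · exact (hcont e).continuousOn.integrableOn_compact (isCompact_closedBall 0 1)
  refine ⟨ENNReal.ofReal (F e)⁻¹ • volume, ⟨fun K hK => ?_⟩, fun x => ?_⟩
  · rw [Measure.smul_apply, smul_eq_mul]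
    exact ENNReal.mul_lt_top ENNReal.ofReal_lt_top hK.measure_lt_top
  · rw [Measure.restrict_smul, integral_smul_measure, ENNReal.toReal_ofReal (by positivity)]
    change (F e)⁻¹ • F x = _
    rw [hF x, smul_eq_mul]
    field_simp

/-- The tensor power `m ↦ ∏ i, ⟪u, m i⟫`. -/
noncomputable def tpow {E : Type*} [NormedAddCommGroup E] [InnerProductSpace ℝ E]
    (k : ℕ) (u : E) : ContinuousMultilinearMap ℝ (fun _ : Fin k => E) ℝ :=
  (ContinuousMultilinearMap.mkPiAlgebra ℝ (Fin k) ℝ).compContinuousLinearMap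
    (fun _ => innerSL ℝ u)

section
variable {E : Type*} [NormedAddCommGroup E] [InnerProductSpace ℝ E]

lemma tpow_apply (k : ℕ) (u : E) (m : Fin k → E) : tpow k u m = ∏ i, inner ℝ u (m i) := by
  simp [tpow]

lemma continuous_tpow (k : ℕ) : Continuous (tpow k : E → _) := by
  have h := (ContinuousMultilinearMap.compContinuousLinearMapLRight
    (E := fun _ : Fin k => E) (ContinuousMultilinearMap.mkPiAlgebra ℝ (Fin k) ℝ)).cont
  have h2 : Continuous (fun u : E => (fun _ : Fin k => innerSL ℝ u)) :=
    continuous_pi fun _ => (innerSL ℝ).continuous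
  exact h.comp h2

lemma tpow_curryLeft (k : ℕ) (u : E) :
    (tpow (k + 1) u).curryLeft = (innerSL ℝ u).smulRight (tpow k u) := by
  ext v m
  simp [tpow_apply, Fin.prod_univ_succ]

/-- Falling factorial. -/
noncomputable def ff (q : ℝ) (k : ℕ) : ℝ := ∏ i ∈ Finset.range k, (q - i)

/-- Integrand of the k-th derivative. -/
noncomputable def gint (q : ℝ) (k : ℕ) (x u : E) :
    ContinuousMultilinearMap ℝ (fun _ : Fin k => E) ℝ :=
  (ff q k * sgnPow (q - k) k (inner ℝ u x)) • tpow k u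

lemma continuous_gint (q : ℝ) (k : ℕ) (h : 0 < q - k) :
    Continuous (Function.uncurry (gint q k : E → E → _)) := by
  unfold gint Function.uncurry
  have h1 : Continuous (fun z : E × E => tpow k z.2) := (continuous_tpow (E := E) k).comp continuous_snd
  have h2 : Continuous (fun z : E × E => ff q k * sgnPow (q - k) k (inner ℝ z.2 z.1)) := continuous_const.mul ((continuous_sgnPow _ h k).comp
    ((continuous_snd.inner continuous_fst : Continuous fun z : E × E => inner ℝ z.2 z.1)))
  exact h2.smul h1

lemma hasFDerivAt_gint (q : ℝ) (k : ℕ) (h : 1 < q - k) (x u : E) :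
    HasFDerivAt (fun x => gint q k x u) (gint q (k + 1) x u).curryLeft x := by
  have h1 := (hasDerivAt_sgnPow (q - k) h k (inner ℝ u x)).const_mul (ff q k)
  have h2 : HasFDerivAt (fun x : E => inner ℝ u x) (innerSL ℝ u) x := (innerSL ℝ u).hasFDerivAt
  have h3 := (h1.comp_hasFDerivAt x h2).smul_const (tpow k u)
  refine h3.congr_fderiv ?_
  have : (gint q (k + 1) x u).curryLeft =
    (ff q (k+1) * sgnPow (q - (k+1:ℕ)) (k+1) (inner ℝ u x)) • (tpow (k + 1) u).curryLeft := rfl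
  rw [this, tpow_curryLeft]
  ext v m
  simp [ff, Finset.prod_range_succ, sub_sub]
  ring

variable [FiniteDimensional ℝ E] [MeasurableSpace E] [BorelSpace E]

/-- The k-th derivative. -/
noncomputable def Gder (μ : Measure E) (q : ℝ) (x : E) : FormalMultilinearSeries ℝ E ℝ := fun k =>
  ∫ u in Metric.closedBall 0 1, gint q k x u ∂μ

lemma continuous_gint_right (q : ℝ) (k : ℕ) (h : 0 < q - k) (x : E) :
    Continuous (gint q k x) :=
  (continuous_gint (E := E) q k h).comp (Continuous.prodMk_right x)

lemma integrable_gint (μ : Measure E) [IsFiniteMeasureOnCompacts μ] (q : ℝ) (k : ℕ)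
    (h : 0 < q - k) (x : E) : IntegrableOn (gint q k x) (Metric.closedBall 0 1) μ :=
  (continuous_gint_right q k h x).continuousOn.integrableOn_compact (isCompact_closedBall 0 1)

lemma hasFDerivAt_Gder (μ : Measure E) [IsFiniteMeasureOnCompacts μ] (q : ℝ) (k : ℕ)
    (h : 1 < q - k) (x : E) :
    HasFDerivAt (fun x => Gder μ q x k) (Gder μ q x (k + 1)).curryLeft x := by
  have h' : 0 < q - (k + 1 : ℕ) := by push_cast; linarith
  let L : (E [×(k+1)]→L[ℝ] ℝ) →L[ℝ] (E →L[ℝ] (E [×k]→L[ℝ] ℝ)) :=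
    ((continuousMultilinearCurryLeftEquiv ℝ (fun _ : Fin (k + 1) => E) ℝ).toContinuousLinearEquiv :
      (E [×(k+1)]→L[ℝ] ℝ) →L[ℝ] (E →L[ℝ] (E [×k]→L[ℝ] ℝ)))
  have e : (Gder μ q x (k + 1)).curryLeft =
      ∫ u in Metric.closedBall 0 1, (gint q (k + 1) x u).curryLeft ∂μ := by
    change L (∫ u in Metric.closedBall 0 1, gint q (k + 1) x u ∂μ) =
      ∫ u in Metric.closedBall 0 1, L (gint q (k + 1) x u) ∂μ
    exact (ContinuousLinearMap.integral_comp_comm (𝕜 := ℝ) (Fₗ := E →L[ℝ] (E [×k]→L[ℝ] ℝ)) L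
      (integrable_gint μ q (k + 1) h' x)).symm
  rw [e]
  have hc : Continuous (fun z : E × E => L (gint q (k + 1) z.1 z.2)) :=
    L.continuous.comp (continuous_gint q (k + 1) h')
  obtain ⟨C, hC⟩ : ∃ C : ℝ, ∀ z ∈ Metric.closedBall x 1 ×ˢ Metric.closedBall (0:E) 1,
      ‖L (gint q (k + 1) z.1 z.2)‖ ≤ C := IsCompact.exists_bound_of_continuousOn
      (E := E →L[ℝ] (E [×k]→L[ℝ] ℝ)) ((isCompact_closedBall x 1).prod
    (isCompact_closedBall (0:E) 1)) hc.continuousOn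
  refine hasFDerivAt_integral_of_dominated_of_fderiv_le (s := Metric.closedBall x 1)
    (F := fun x u => gint q k x u) (F' := fun x u => (gint q (k + 1) x u).curryLeft)
    (bound := fun _ => C) (Metric.closedBall_mem_nhds x one_pos) ?_ ?_ ?_ ?_ ?_ ?_
  · exact Filter.Eventually.of_forall fun y =>
      (integrable_gint μ q k (by linarith) y).aestronglyMeasurable
  · exact integrable_gint μ q k (by linarith) x
  · exact (ContinuousLinearMap.integrable_comp (𝕜 := ℝ) (𝕜' := ℝ) (σ := RingHom.id ℝ) (H := E [×(k+1)]→L[ℝ] ℝ)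
      (E := E →L[ℝ] (E [×k]→L[ℝ] ℝ)) L (integrable_gint μ q (k + 1) h' x)).aestronglyMeasurable
  · filter_upwards [ae_restrict_mem Metric.isClosed_closedBall.measurableSet] with u hu y hy
    exact hC (y, u) ⟨hy, hu⟩
  · exact continuous_const.continuousOn.integrableOn_compact (isCompact_closedBall 0 1)
  · exact Filter.Eventually.of_forall fun u y _ => hasFDerivAt_gint q k h y u

lemma hasFTaylor (μ : Measure E) [IsFiniteMeasureOnCompacts μ] (p : ℕ) (ν : ℝ) (hν : 0 < ν)
    (hμ : ∀ x : E, ∫ u in Metric.closedBall 0 1, |inner ℝ u x| ^ (p + ν) ∂μ = ‖x‖ ^ (p + ν)) :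
    HasFTaylorSeriesUpTo p (fun x : E => ‖x‖ ^ (p + ν)) (Gder μ (p + ν)) := by
  constructor
  · intro x
    change (∫ u in Metric.closedBall 0 1, gint (p + ν) 0 x u ∂μ) 0 = _
    rw [ContinuousMultilinearMap.integral_apply
      (integrable_gint μ _ 0 (by push_cast; linarith [(Nat.cast_nonneg p : (0:ℝ) ≤ p)]) x), ← hμ x]
    simp [gint, ff, sgnPow, tpow_apply]
  · intro m hm x
    have hm' : m + 1 ≤ p := by exact_mod_cast hm
    have : (m : ℝ) + 1 ≤ p := by exact_mod_cast hm'
    exact hasFDerivAt_Gder μ _ m (by linarith) x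
  · intro m hm
    have hm' : m ≤ p := by exact_mod_cast hm
    have : (m : ℝ) ≤ p := by exact_mod_cast hm'
    exact continuous_parametric_integral_of_continuous (continuous_gint _ m (by linarith))
      (isCompact_closedBall 0 1)

lemma young_aux (p : ℕ) (ν : ℝ) (hν : 0 < ν) (A : ℝ) (hA : 0 ≤ A) (B : Fin p → ℝ)
    (hB : ∀ i, 0 ≤ B i) :
    A ^ ν * ∏ i, B i ≤ ν / (p + ν) * A ^ (p + ν) + ∑ i, 1 / (p + ν) * B i ^ (p + ν) := by
  have hq : (0:ℝ) < p + ν := by positivity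
  have h := Real.geom_mean_le_arith_mean_weighted (Finset.univ : Finset (Fin (p + 1)))
    (Fin.cons (ν / (p + ν)) (fun _ => 1 / (p + ν)))
    (Fin.cons (A ^ (p + ν)) (fun i => B i ^ (p + ν))) ?_ ?_ ?_
  · simp only [Fin.prod_univ_succ, Fin.sum_univ_succ, Fin.cons_zero, Fin.cons_succ] at h
    refine le_trans (le_of_eq ?_) h
    rw [← Real.rpow_mul hA, mul_div_cancel₀ _ hq.ne']
    congr 1
    refine Finset.prod_congr rfl fun i _ => ?_
    rw [← Real.rpow_mul (hB i), mul_one_div_cancel hq.ne', Real.rpow_one]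
  · intro i _
    refine Fin.cases ?_ (fun j => ?_) i <;> simp <;> positivity
  · simp [Fin.sum_univ_succ]
    field_simp
    ring
  · intro i _
    refine Fin.cases ?_ (fun j => ?_) i <;> simp
    · positivity
    · exact Real.rpow_nonneg (hB j) _

/-- Hölder inequality. -/
lemma holder_int (μ : Measure E) [IsFiniteMeasureOnCompacts μ] (p : ℕ) (ν : ℝ) (hν : 0 < ν)
    (hμ : ∀ x : E, ∫ u in Metric.closedBall 0 1, |inner ℝ u x| ^ (p + ν) ∂μ = ‖x‖ ^ (p + ν))
    (z : E) (m : Fin p → E) :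
    ∫ u in Metric.closedBall 0 1, |inner ℝ u z| ^ ν * ∏ i, |inner ℝ u (m i)| ∂μ ≤
      ‖z‖ ^ ν * ∏ i, ‖m i‖ := by
  have hq : (0:ℝ) < p + ν := by positivity
  by_cases hz : z = 0
  · subst hz; simp [Real.zero_rpow hν.ne']
  by_cases hm : ∃ i, m i = 0
  · obtain ⟨i, hi⟩ := hm
    have h1 : ∀ u : E, ∏ i, |inner ℝ u (m i)| = 0 := fun u =>
      Finset.prod_eq_zero (Finset.mem_univ i) (by simp [hi])
    have h2 : ∏ i, ‖m i‖ = 0 := Finset.prod_eq_zero (Finset.mem_univ i) (by simp [hi])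
    simp [h1, h2]
  push Not at hm
  have hint : ∀ x : E, IntegrableOn (fun u : E => |inner ℝ u x| ^ (p + ν)) (Metric.closedBall 0 1) μ :=
    fun x => (((continuous_id.inner continuous_const).abs).rpow_const
      (fun _ => Or.inr hq.le)).continuousOn.integrableOn_compact (isCompact_closedBall 0 1)
  have hz' : 0 < ‖z‖ := norm_pos_iff.2 hz
  have hm' : ∀ i, 0 < ‖m i‖ := fun i => norm_pos_iff.2 (hm i)
  have hP : 0 < ∏ i, ‖m i‖ := Finset.prod_pos fun i _ => hm' i
  have hzν : 0 < ‖z‖ ^ ν := Real.rpow_pos_of_pos hz' _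
  let R : E → ℝ := fun u => ν / (p + ν) * (|inner ℝ u z| ^ (p + ν) / ‖z‖ ^ (p + ν)) +
    ∑ i, 1 / (p + ν) * (|inner ℝ u (m i)| ^ (p + ν) / ‖m i‖ ^ (p + ν))
  have hpt : ∀ u : E, |inner ℝ u z| ^ ν * ∏ i, |inner ℝ u (m i)| ≤
      (‖z‖ ^ ν * ∏ i, ‖m i‖) * R u := by
    intro u
    have h := young_aux p ν hν (|inner ℝ u z| / ‖z‖) (by positivity)
      (fun i => |inner ℝ u (m i)| / ‖m i‖) (fun i => by positivity)
    rw [Real.div_rpow (abs_nonneg _) hz'.le, Real.div_rpow (abs_nonneg _) hz'.le,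
      Finset.prod_div_distrib, div_mul_div_comm, div_le_iff₀ (by positivity)] at h
    refine h.trans (le_of_eq ?_)
    rw [mul_comm]
    congr 2
    refine Finset.sum_congr rfl fun i _ => ?_
    rw [Real.div_rpow (abs_nonneg _) (hm' i).le]
  have i1 : IntegrableOn (fun u : E => ν / (p + ν) * (|inner ℝ u z| ^ (p + ν) / ‖z‖ ^ (p + ν)))
      (Metric.closedBall 0 1) μ := ((hint z).div_const _).const_mul _
  have i2 : ∀ i, IntegrableOn
      (fun u : E => 1 / (p + ν) * (|inner ℝ u (m i)| ^ (p + ν) / ‖m i‖ ^ (p + ν)))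
      (Metric.closedBall 0 1) μ := fun i => ((hint (m i)).div_const _).const_mul _
  have i3 := integrable_finsetSum Finset.univ (fun i _ => i2 i)
  have hR : ∫ u in Metric.closedBall 0 1, R u ∂μ = 1 := by
    simp only [R]
    rw [integral_add i1 i3, integral_finsetSum _ (fun i _ => i2 i)]
    simp only [integral_const_mul, integral_div, hμ]
    rw [div_self (Real.rpow_pos_of_pos hz' _).ne']
    have : ∀ i, ‖m i‖ ^ (p + ν) / ‖m i‖ ^ (p + ν) = 1 := fun i =>
      div_self (Real.rpow_pos_of_pos (hm' i) _).ne'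
    simp only [this]
    simp
    field_simp
    ring
  have hmono := integral_mono (μ := μ.restrict (Metric.closedBall 0 1))
    (f := fun u : E => |inner ℝ u z| ^ ν * ∏ i, |inner ℝ u (m i)|)
    (g := fun u => (‖z‖ ^ ν * ∏ i, ‖m i‖) * R u) ?_ ((i1.add i3).const_mul _) hpt
  · rwa [integral_const_mul, hR, mul_one] at hmono
  · refine ContinuousOn.integrableOn_compact (isCompact_closedBall 0 1) (Continuous.continuousOn ?_)
    refine Continuous.mul ?_ ?_
    · exact ((continuous_id.inner continuous_const).abs).rpow_const (fun _ => Or.inr hν.le)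
    · exact continuous_finsetProd _ fun i _ => (continuous_id.inner continuous_const).abs

lemma ff_eq (p : ℕ) (ν : ℝ) : ff (p + ν) p = ∏ i ∈ Finset.Icc 1 p, (ν + (i : ℝ)) := by
  unfold ff
  rw [← Finset.prod_range_reflect, Finset.range_eq_Ico, Finset.prod_Ico_eq_prod_range,
    ← Finset.Ico_add_one_right_eq_Icc, Finset.prod_Ico_eq_prod_range]
  refine Finset.prod_congr (by simp) fun i hi => ?_
  have : i < p := by simpa using hi
  have h2 : ((p - 1 - (0 + i) : ℕ) : ℝ) = p - 1 - i := by
    rw [zero_add, Nat.cast_sub (by omega), Nat.cast_sub (by omega)]; simp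
  rw [h2]
  push_cast
  ring

lemma main_pos (p : ℕ) (ν : ℝ) (hν : 0 < ν) (c : ℝ)
    (hc : ∀ a b, |sgnPow ν p a - sgnPow ν p b| ≤ c * |a - b| ^ ν) (hc0 : 0 ≤ c) (x y : E) :
    ‖iteratedFDeriv ℝ p (fun z : E => ‖z‖ ^ ((p : ℝ) + ν)) x
        - iteratedFDeriv ℝ p (fun z : E => ‖z‖ ^ ((p : ℝ) + ν)) y‖ ≤
      (c * ∏ i ∈ Finset.Icc 1 p, (ν + (i : ℝ))) * ‖x - y‖ ^ ν := by
  have hP : 0 ≤ ∏ i ∈ Finset.Icc 1 p, (ν + (i : ℝ)) := Finset.prod_nonneg fun i _ => by positivity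
  rcases subsingleton_or_nontrivial E with hE | hE
  · rw [Subsingleton.elim x y, sub_self, norm_zero]
    positivity
  obtain ⟨μ, hμf, hμ⟩ := exists_good_measure (E := E) ((p : ℝ) + ν) (by positivity)
  have hT := hasFTaylor μ p ν hν hμ
  rw [← hT.eq_iteratedFDeriv le_rfl, ← hT.eq_iteratedFDeriv le_rfl]
  refine ContinuousMultilinearMap.opNorm_le_bound (by positivity) fun m => ?_
  have hi := fun x : E => integrable_gint μ ((p : ℝ) + ν) p (by linarith) x
  have h1 : (Gder μ (p + ν) x p - Gder μ (p + ν) y p) m =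
      ∫ u in Metric.closedBall 0 1, (gint (p + ν) p x u - gint (p + ν) p y u) m ∂μ := by
    unfold Gder
    rw [← integral_sub (hi x) (hi y)]
    exact ContinuousMultilinearMap.integral_apply ((hi x).sub (hi y)) m
  rw [h1]
  have h2 : ∀ u : E, ‖(gint (p + ν) p x u - gint (p + ν) p y u) m‖ ≤
      (c * ∏ i ∈ Finset.Icc 1 p, (ν + (i : ℝ))) *
        (|inner ℝ u (x - y)| ^ ν * ∏ i, |inner ℝ u (m i)|) := by
    intro u
    have e : (gint (p + ν) p x u - gint (p + ν) p y u) m =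
        (∏ i ∈ Finset.Icc 1 p, (ν + (i : ℝ))) *
        (sgnPow ν p (inner ℝ u x) - sgnPow ν p (inner ℝ u y)) * ∏ i, inner ℝ u (m i) := by
      simp [gint, ff_eq, tpow_apply]
      ring
    rw [e, Real.norm_eq_abs, abs_mul, abs_mul, abs_of_nonneg hP, Finset.abs_prod, inner_sub_right]
    have := hc (inner ℝ u x) (inner ℝ u y)
    have hB : 0 ≤ ∏ i, |inner ℝ u (m i)| := Finset.prod_nonneg fun i _ => abs_nonneg _
    calc _ ≤ (∏ i ∈ Finset.Icc 1 p, (ν + (i : ℝ))) *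
          (c * |inner ℝ u x - inner ℝ u y| ^ ν) * ∏ i, |inner ℝ u (m i)| := by gcongr
      _ = _ := by ring
  have hI : IntegrableOn (fun u : E => |inner ℝ u (x - y)| ^ ν * ∏ i, |inner ℝ u (m i)|)
      (Metric.closedBall 0 1) μ := by
    refine ContinuousOn.integrableOn_compact (isCompact_closedBall 0 1) (Continuous.continuousOn ?_)
    refine Continuous.mul ?_ ?_
    · exact ((continuous_id.inner continuous_const).abs).rpow_const (fun _ => Or.inr hν.le)
    · exact continuous_finsetProd _ fun i _ => (continuous_id.inner continuous_const).abs
  refine (norm_integral_le_of_norm_le (hI.const_mul _) (Filter.Eventually.of_forall h2)).trans ?_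
  rw [integral_const_mul, mul_assoc _ (‖x - y‖ ^ ν)]
  exact mul_le_mul_of_nonneg_left (holder_int μ p ν hν hμ (x - y) m) (by positivity)

end

theorem power_of_norm_holder_derivative
    {E : Type*} [NormedAddCommGroup E] [InnerProductSpace ℝ E] [FiniteDimensional ℝ E]
    (p : ℕ) (hp : 1 ≤ p) (ν : ℝ) (hν : ν ∈ Set.Icc (0:ℝ) 1) (x₀ : E) :
    ∀ x y : E,
      ‖iteratedFDeriv ℝ p (fun z => ‖z - x₀‖ ^ ((p : ℝ) + ν)) x
        - iteratedFDeriv ℝ p (fun z => ‖z - x₀‖ ^ ((p : ℝ) + ν)) y‖ ≤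
      (2 * ∏ i ∈ Finset.Icc 1 p, (ν + (i : ℝ))) * ‖x - y‖ ^ ν := by
  intro x y
  borelize E
  rw [iteratedFDeriv_comp_sub (f := fun z : E => ‖z‖ ^ ((p : ℝ) + ν)),
    iteratedFDeriv_comp_sub (f := fun z : E => ‖z‖ ^ ((p : ℝ) + ν))]
  rcases hν.1.lt_or_eq with h0 | h0
  · have := main_pos p ν h0 2 (sgnPow_holder h0 hν.2 p) (by norm_num) (x - x₀) (y - x₀)
    rwa [sub_sub_sub_cancel_right] at this
  · subst h0
    obtain ⟨n, rfl⟩ : ∃ n, p = n + 1 := ⟨p - 1, by omega⟩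
    let f : E → ℝ := fun z => ‖z‖ ^ (((n + 1 : ℕ) : ℝ) + 0)
    have hf : f = fun z : E => ‖z‖ ^ ((n : ℝ) + 1) := by
      ext z; simp [f]
    have hprod : ∏ i ∈ Finset.Icc 1 n, ((1:ℝ) + (i : ℝ)) =
        ∏ i ∈ Finset.Icc 1 (n + 1), ((0:ℝ) + (i : ℝ)) := by
      rw [← ff_eq, ← ff_eq, ff, ff, Finset.prod_range_succ]
      simp
    have hlip : LipschitzWith (Real.toNNReal (∏ i ∈ Finset.Icc 1 (n + 1), ((0:ℝ) + (i : ℝ))))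
        (iteratedFDeriv ℝ n f) := by
      refine LipschitzWith.of_dist_le_mul fun a b => ?_
      have := main_pos n 1 one_pos 1 (sgnPow_lip n) zero_le_one a b
      rw [← hf, hprod, one_mul, Real.rpow_one] at this
      rw [dist_eq_norm, dist_eq_norm, Real.coe_toNNReal _ (Finset.prod_nonneg fun i _ => by positivity)]
      exact this
    have hb : ∀ z, ‖iteratedFDeriv ℝ (n + 1) f z‖ ≤ ∏ i ∈ Finset.Icc 1 (n + 1), ((0:ℝ) + (i : ℝ)) := by
      intro z
      have := norm_fderiv_le_of_lipschitz ℝ (x₀ := z) hlip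
      rwa [norm_fderiv_iteratedFDeriv,
        Real.coe_toNNReal _ (Finset.prod_nonneg fun i _ => by positivity)] at this
    rw [Real.rpow_zero, mul_one, two_mul]
    exact (norm_sub_le _ _).trans (add_le_add (hb _) (hb _))
end
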